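/- For the strong seed-bank urn chain with parameters β > 0 and ε ∈ (0,1): for all λ > 3β there exist δ > 0 and N₀ such that for all N ≥ N₀ and all initial distributions μ on {0,...,N^β−1}, ‖P_μ(X_{⌊N^λ⌋} ∈ ·) − ν_N‖_TV ≤ e^{−N^δ}. -/

import Mathlib

open Matrix

/-- Transition kernel of the urn chain on `{0,...,M-1}` (with `M = N^β`). -/
def urnP (M : ℕ) (ε : ℝ) (i j : Fin M) : ℝ :=
  if i.val = 0 then
    (if j.val = 0 then 1 - ε else if j.val = M - 1 then ε else 0)
  else if j.val + 1 = i.val then 1 else 0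

/-- The urn chain as a transition matrix. -/
def urnMat (M : ℕ) (ε : ℝ) : Matrix (Fin M) (Fin M) ℝ := Matrix.of (urnP M ε)

/-- The stationary distribution `ν_N` of the urn chain. -/
noncomputable def urnNu (M : ℕ) (ε : ℝ) (k : Fin M) : ℝ :=
  ((if k.val + 1 ≤ 1 then 1 - ε else 0) + (if k.val + 1 ≤ M then ε else 0)) /
    (1 + ε * (M - 1))

/-- Total variation distance between two probability vectors on a finite state space. -/
noncomputable def tvDist {S : Type*} [Fintype S] (f g : S → ℝ) : ℝ :=
  (∑ s, |f s - g s|) / 2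

lemma urn_poinc (m : ℕ) (ε : ℝ) (hε : 0 < ε) (b : ℕ → ℝ)
    (h0 : b m + ε * ∑ k ∈ Finset.range m, b k = 0) (i : ℕ) (hi : i ≤ m) :
    b i ^ 2 ≤ m * ∑ k ∈ Finset.range m, (b (k+1) - b k) ^ 2 := by
  set D := ∑ k ∈ Finset.range m, |b (k+1) - b k| with hD
  have hle : ∀ i j, i ≤ j → j ≤ m → |b i - b j| ≤ D := by
    intro i j hij hj
    have h1 := dist_le_Ico_sum_dist b hij
    rw [Real.dist_eq] at h1
    refine h1.trans ?_
    have h2 : ∑ k ∈ Finset.Ico i j, dist (b k) (b (k+1)) = ∑ k ∈ Finset.Ico i j, |b (k+1) - b k| := by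
      refine Finset.sum_congr rfl fun k _ => ?_
      rw [Real.dist_eq, abs_sub_comm]
    rw [h2]
    refine Finset.sum_le_sum_of_subset_of_nonneg ?_ (fun _ _ _ => abs_nonneg _)
    intro k hk
    simp only [Finset.mem_Ico, Finset.mem_range] at *
    omega
  have hle2 : ∀ j, j ≤ m → |b i - b j| ≤ D := by
    intro j hj
    rcases le_total i j with h | h
    · exact hle i j h hj
    · rw [abs_sub_comm]; exact hle j i h hi
  have hU : ∑ k ∈ Finset.range m, (b i - b k) ≤ m * D := by
    have := Finset.sum_le_card_nsmul (Finset.range m) (fun k => b i - b k) D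
      (fun k hk => (abs_le.mp (hle2 k (Finset.mem_range.mp hk).le)).2)
    simpa using this
  have hL : -(m * D) ≤ ∑ k ∈ Finset.range m, (b i - b k) := by
    have := Finset.card_nsmul_le_sum (Finset.range m) (fun k => b i - b k) (-D)
      (fun k hk => (abs_le.mp (hle2 k (Finset.mem_range.mp hk).le)).1)
    simpa using this
  have hS : ∑ k ∈ Finset.range m, (b i - b k) = m * b i - ∑ k ∈ Finset.range m, b k := by
    simp
  rw [hS] at hU hL
  have hm := abs_le.mp (hle2 m le_rfl)
  have hpos : 0 < 1 + ε * m := by positivity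
  have habs : |b i| ≤ D := by
    rw [abs_le]
    constructor
    · nlinarith [mul_le_mul_of_nonneg_left hL hε.le]
    · nlinarith [mul_le_mul_of_nonneg_left hU hε.le]
  have h1 : b i ^ 2 ≤ D ^ 2 := by
    rw [← sq_abs (b i)]
    exact pow_le_pow_left₀ (abs_nonneg _) habs 2
  refine h1.trans ?_
  have := sq_sum_le_card_mul_sum_sq (s := Finset.range m) (f := fun k => |b (k+1) - b k|)
  simpa using this

lemma urn_W_step (m : ℕ) (ε : ℝ) (hε : 0 < ε) (a : ℕ → ℝ)
    (hrec : ∀ n, a (n+m+1) = (1-ε) * a (n+m) + ε * a n) (n : ℕ) :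
    (a (n+m)^2 + ε * ∑ k ∈ Finset.range m, a (n+k)^2) -
    (a (n+1+m)^2 + ε * ∑ k ∈ Finset.range m, a (n+1+k)^2) =
      (1-ε)/ε * (a (n+m+1) - a (n+m))^2 := by
  have h1 := Finset.sum_range_succ (fun k => a (n+k)^2) m
  have h2 := Finset.sum_range_succ' (fun k => a (n+k)^2) m
  have h3 : ∑ k ∈ Finset.range m, a (n+1+k)^2 = ∑ k ∈ Finset.range m, a (n+(k+1))^2 :=
    Finset.sum_congr rfl fun k _ => by rw [show n+1+k = n+(k+1) by ring]
  have h4 : a (n+1+m) = a (n+m+1) := by rw [show n+1+m = n+m+1 by ring]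
  simp only [add_zero] at h2
  have h5 : ∑ k ∈ Finset.range m, a (n+(k+1))^2 = ∑ k ∈ Finset.range m, a (n+k)^2 + a (n+m)^2 - a n ^2 := by
    linarith
  rw [h3, h5, h4, hrec]
  field_simp
  ring

lemma urn_mean (m : ℕ) (ε : ℝ) (a : ℕ → ℝ)
    (hrec : ∀ n, a (n+m+1) = (1-ε) * a (n+m) + ε * a n)
    (h0 : a m + ε * ∑ k ∈ Finset.range m, a k = 0) (n : ℕ) :
    a (n+m) + ε * ∑ k ∈ Finset.range m, a (n+k) = 0 := by
  induction n with
  | zero => simpa using h0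
  | succ n ih =>
    have h1 := Finset.sum_range_succ (fun k => a (n+k)) m
    have h2 := Finset.sum_range_succ' (fun k => a (n+k)) m
    have h3 : ∑ k ∈ Finset.range m, a (n+1+k) = ∑ k ∈ Finset.range m, a (n+(k+1)) :=
      Finset.sum_congr rfl fun k _ => by rw [show n+1+k = n+(k+1) by ring]
    have h4 : a (n+1+m) = a (n+m+1) := by rw [show n+1+m = n+m+1 by ring]
    simp only [add_zero] at h2
    have h5 : ∑ k ∈ Finset.range m, a (n+(k+1)) = ∑ k ∈ Finset.range m, a (n+k) + a (n+m) - a n := by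
      linarith
    rw [h3, h5, h4, hrec]
    linarith

lemma urn_seq (m : ℕ) (hm : 1 ≤ m) (ε : ℝ) (hε : 0 < ε) (hε1 : ε < 1) (a : ℕ → ℝ)
    (hrec : ∀ n, a (n+m+1) = (1-ε) * a (n+m) + ε * a n)
    (h0 : a m + ε * ∑ k ∈ Finset.range m, a k = 0) (hb : ∀ n, |a n| ≤ 1) (t k : ℕ) (hk : k ≤ m) :
    a (t + k) ^ 2 ≤ (1 + m) / ε * Real.exp (-((1-ε)/(2*(1+m)^2)) * (t/m : ℕ)) := by
  set W : ℕ → ℝ := fun n => a (n+m)^2 + ε * ∑ k ∈ Finset.range m, a (n+k)^2 with hW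
  have hstep : ∀ n, W n - W (n+1) = (1-ε)/ε * (a (n+m+1) - a (n+m))^2 :=
    fun n => urn_W_step m ε hε a hrec n
  have hfac : 0 ≤ (1-ε)/ε := div_nonneg (by linarith) hε.le
  have hanti : Antitone W := antitone_nat_of_succ_le fun n => by
    have := hstep n
    have h2 := mul_nonneg hfac (sq_nonneg (a (n+m+1) - a (n+m)))
    linarith
  have hsumW : ∀ n, W n - W (n+m) = (1-ε)/ε * ∑ k ∈ Finset.range m, (a (n+m+(k+1)) - a (n+m+k))^2 := by
    intro n
    have h1 := Finset.sum_range_sub' (fun k => W (n+k)) m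
    simp only [add_zero] at h1
    rw [← h1, Finset.mul_sum]
    refine Finset.sum_congr rfl fun k _ => ?_
    have := hstep (n+k)
    rw [show n + k + m + 1 = n+m+(k+1) by ring, show n+k+m = n+m+k by ring] at this
    exact this
  have hmR : (1:ℝ) ≤ m := by exact_mod_cast hm
  have hWnn : ∀ n, 0 ≤ W n := fun n => by simp only [hW]; positivity
  set c : ℝ := (1-ε)/(2*(1+m)^2) with hc
  have hcontr : ∀ n, W (n+m) ≤ Real.exp (-c) * W n := by
    intro n
    set S := ∑ k ∈ Finset.range m, (a (n+m+(k+1)) - a (n+m+k))^2 with hS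
    have hSnn : 0 ≤ S := Finset.sum_nonneg fun _ _ => sq_nonneg _
    have hp := urn_poinc m ε hε (fun k => a (n+m+k)) (urn_mean m ε a hrec h0 (n+m))
    have hWle : W (n+m) ≤ (1+m) * (m * S) := by
      have h1 : ∑ k ∈ Finset.range m, a (n+m+k)^2 ≤ m * (m * S) := by
        have := Finset.sum_le_card_nsmul (Finset.range m) (fun k => a (n+m+k)^2) (m*S)
          (fun k hk => hp k (Finset.mem_range.mp hk).le)
        simpa using this
      have h2 := hp m le_rfl
      have h3 : 0 ≤ ∑ k ∈ Finset.range m, a (n+m+k)^2 := Finset.sum_nonneg fun _ _ => sq_nonneg _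
      simp only [hW]
      nlinarith
    have hD : (1-ε) * S ≤ W n - W (n+m) := by
      rw [hsumW n]
      refine mul_le_mul_of_nonneg_right ?_ hSnn
      rw [le_div_iff₀ hε]; nlinarith
    -- W(n+m) * (1-ε) ≤ (1+m)^2 (W n - W(n+m))
    have h5 : W (n+m) * (2*c) ≤ W n - W (n+m) := by
      have h6 : W (n+m) * (1-ε) ≤ (W n - W (n+m)) * (1+m)^2 := by
        have h7 : W (n+m) ≤ (1+m)^2 * S := by nlinarith
        calc W (n+m) * (1-ε) ≤ ((1+m)^2 * S) * (1-ε) :=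
              mul_le_mul_of_nonneg_right h7 (by linarith)
          _ = ((1-ε) * S) * (1+m)^2 := by ring
          _ ≤ _ := mul_le_mul_of_nonneg_right hD (by positivity)
      have : W (n+m) * (2*c) = W (n+m) * (1-ε) / (1+m)^2 := by
        rw [hc]; field_simp
      rw [this, div_le_iff₀ (by positivity)]
      exact h6
    have hc0 : 0 ≤ c := div_nonneg (by linarith) (by positivity)
    have hc1 : c ≤ 1/2 := by
      rw [hc, div_le_iff₀ (by positivity)]; nlinarith
    have h8 : W (n+m) ≤ (1-c) * W n := by
      have : 0 ≤ W (n+m) := hWnn _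
      have hn := hWnn n
      have e : (1 : ℝ) ≤ (1-c)*(1+2*c) := by nlinarith
      calc W (n+m) = 1 * W (n+m) := by ring
        _ ≤ ((1-c)*(1+2*c)) * W (n+m) := mul_le_mul_of_nonneg_right e this
        _ = (1-c) * (W (n+m) + W (n+m) * (2*c)) := by ring
        _ ≤ (1-c) * W n := mul_le_mul_of_nonneg_left (by linarith) (by linarith)
    exact h8.trans (mul_le_mul_of_nonneg_right (Real.one_sub_le_exp_neg c) (hWnn n))
  have hiter : ∀ j : ℕ, W (j*m) ≤ Real.exp (-c * j) * W 0 := by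
    intro j
    induction j with
    | zero => simp
    | succ j ih =>
      have h1 := hcontr (j*m)
      rw [show j*m+m = (j+1)*m by ring] at h1
      refine h1.trans ((mul_le_mul_of_nonneg_left ih (Real.exp_pos _).le).trans (le_of_eq ?_))
      rw [← mul_assoc, ← Real.exp_add]; push_cast; ring_nf
  have hW0 : W 0 ≤ 1 + m := by
    have hs : ∀ n, a n ^ 2 ≤ 1 := fun n => by rw [sq_le_one_iff_abs_le_one]; exact hb n
    have h1 : ∑ k ∈ Finset.range m, a (0+k)^2 ≤ m := by
      have := Finset.sum_le_card_nsmul (Finset.range m) (fun k => a (0+k)^2) 1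
          (fun k hk => hs _)
      simpa using this
    have h3 : 0 ≤ ∑ k ∈ Finset.range m, a (0+k)^2 := Finset.sum_nonneg fun _ _ => sq_nonneg _
    have := hs (0+m)
    simp only [hW]
    nlinarith
  have hak : ε * a (t+k)^2 ≤ W t := by
    have h3 : 0 ≤ ∑ k ∈ Finset.range m, a (t+k)^2 := Finset.sum_nonneg fun _ _ => sq_nonneg _
    rcases hk.eq_or_lt with rfl | hk
    · simp only [hW]
      nlinarith [sq_nonneg (a (t+k))]
    · have := Finset.single_le_sum (f := fun k => a (t+k)^2) (fun _ _ => sq_nonneg _) (Finset.mem_range.mpr hk)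
      simp only [hW]
      nlinarith [sq_nonneg (a (t+m))]
  have hfin : ε * a (t+k)^2 ≤ Real.exp (-c * (t/m : ℕ)) * (1+m) :=
    hak.trans ((hanti (Nat.div_mul_le_self t m)).trans ((hiter _).trans
      (mul_le_mul_of_nonneg_left hW0 (Real.exp_pos _).le)))
  rw [div_mul_eq_mul_div, le_div_iff₀ hε]
  linarith

lemma urn_mul_zero (m : ℕ) (hm : 1 ≤ m) (ε : ℝ) (g : Fin (m+1) → ℝ) :
    ∑ j, urnP (m+1) ε 0 j * g j = (1-ε) * g 0 + ε * g (Fin.last m) := by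
  have h : ∀ j : Fin (m+1), urnP (m+1) ε 0 j * g j =
      (if j = 0 then (1-ε) * g 0 else 0) + (if j = Fin.last m then ε * g (Fin.last m) else 0) := by
    intro j
    by_cases h0 : j = 0
    · subst h0
      have : (0 : Fin (m+1)) ≠ Fin.last m := by
        intro h; have := congrArg Fin.val h; simp at this; omega
      simp [urnP, this]
    · have h0' : j.val ≠ 0 := fun h => h0 (Fin.ext h)
      by_cases h1 : j = Fin.last m
      · subst h1
        have h2 : m ≠ 0 := by omega
        simp [urnP, h0, h2]
      · have h1' : j.val ≠ m := fun h => h1 (Fin.ext h)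
        simp [urnP, h0, h1, h1']
  rw [Finset.sum_congr rfl fun j _ => h j, Finset.sum_add_distrib]
  simp

lemma urn_mul_succ (m : ℕ) (ε : ℝ) (g : Fin (m+1) → ℝ) (i : Fin m) :
    ∑ j, urnP (m+1) ε i.succ j * g j = g i.castSucc := by
  rw [Finset.sum_eq_single i.castSucc]
  · simp [urnP]
  · intro j _ hj
    have : j.val ≠ i.val := fun h => hj (Fin.ext h)
    simp [urnP, this]
  · simp

lemma urn_bound (m : ℕ) (hm : 1 ≤ m) (ε : ℝ) (hε : 0 < ε) (hε1 : ε < 1) (t : ℕ)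
    (i s : Fin (m+1)) :
    |((urnMat (m+1) ε) ^ (t+m)) i s - urnNu (m+1) ε s| ≤
      (1 + m) / ε * Real.exp (-((1-ε)/(4*(1+m)^2)) * (t/m : ℕ)) := by
  set P := urnMat (m+1) ε with hP
  set v := urnNu (m+1) ε s with hv
  have hmR : (1:ℝ) ≤ m := by exact_mod_cast hm
  have r0 : ∀ n, (P^(n+1)) 0 s = (1-ε) * (P^n) 0 s + ε * (P^n) (Fin.last m) s := by
    intro n
    rw [pow_succ', Matrix.mul_apply]
    exact urn_mul_zero m hm ε (fun j => (P^n) j s)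
  have r1 : ∀ n (k : Fin m), (P^(n+1)) k.succ s = (P^n) k.castSucc s := by
    intro n k
    rw [pow_succ', Matrix.mul_apply]
    exact urn_mul_succ m ε (fun j => (P^n) j s) k
  have hshift : ∀ (k : ℕ) (hk : k < m+1) (n : ℕ), (P^(n+k)) ⟨k, hk⟩ s = (P^n) 0 s := by
    intro k
    induction k with
    | zero => intro hk n; rfl
    | succ k ih =>
      intro hk n
      have := r1 (n+k) ⟨k, by omega⟩
      rw [← add_assoc]
      exact this.trans (ih (by omega) n)
  have h01 : ∀ n (k : Fin (m+1)), 0 ≤ (P^n) k s ∧ (P^n) k s ≤ 1 := by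
    intro n
    induction n with
    | zero =>
      intro k
      rw [pow_zero, Matrix.one_apply]
      split_ifs <;> norm_num
    | succ n ih =>
      intro k
      refine Fin.cases ?_ (fun k => ?_) k
      · rw [r0]
        have h1 := ih 0
        have h2 := ih (Fin.last m)
        constructor <;> nlinarith
      · rw [r1]; exact ih _
  have hZ : 0 < 1 + ε * m := by positivity
  have hvs : v = (if s = 0 then 1 else ε) / (1 + ε * m) := by
    have hs : s.val + 1 ≤ m + 1 := by omega
    by_cases h : s = 0
    · subst h; simp [hv, urnNu]
    · have h' : s.val ≠ 0 := fun h1 => h (Fin.ext h1)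
      rw [hv, urnNu, if_neg (by omega), if_pos hs, if_neg h]
      push_cast; ring
  have hv01 : 0 ≤ v ∧ v ≤ 1 := by
    rw [hvs]
    constructor
    · split_ifs <;> positivity
    · rw [div_le_one hZ]; split_ifs <;> nlinarith
  have hstat : ∀ n, (P^n) 0 s + ε * ∑ k : Fin m, (P^n) k.succ s = (1 + ε * m) * v := by
    intro n
    induction n with
    | zero =>
      rw [hvs, pow_zero, mul_div_cancel₀ _ hZ.ne']
      refine Fin.cases ?_ (fun k => ?_) s
      · simp
      · simp [Matrix.one_apply, Fin.succ_ne_zero, (Fin.succ_ne_zero _).symm]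
    | succ n ih =>
      rw [← ih, r0]
      simp only [r1]
      have h1 := Fin.sum_univ_succ (fun k => (P^n) k s)
      have h2 := Fin.sum_univ_castSucc (fun k => (P^n) k s)
      have : ∑ k : Fin m, (P^n) k.castSucc s = (P^n) 0 s + ∑ k : Fin m, (P^n) k.succ s - (P^n) (Fin.last m) s := by
        linarith
      rw [this]; ring
  set a : ℕ → ℝ := fun n => (P^n) 0 s - v with ha
  have hrec : ∀ n, a (n+m+1) = (1-ε) * a (n+m) + ε * a n := by
    intro n
    have := hshift m (by omega) n
    simp only [ha]
    rw [r0]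
    have e : (P^(n+m)) (Fin.last m) s = (P^n) 0 s := this
    rw [e]; ring
  have h0 : a m + ε * ∑ k ∈ Finset.range m, a k = 0 := by
    have h1 := hstat m
    have h2 : ∑ k : Fin m, (P^m) k.succ s = ∑ k ∈ Finset.range m, (P^k) 0 s := by
      rw [← Finset.sum_range_reflect, Finset.sum_range]
      refine Finset.sum_congr rfl fun k _ => ?_
      have := hshift (k+1) (by omega) (m-1-k)
      rw [show m - 1 - (k:ℕ) + (k+1) = m by omega] at this
      exact this
    rw [h2] at h1
    simp only [ha, Finset.sum_sub_distrib, Finset.sum_const, Finset.card_range, nsmul_eq_mul]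
    linarith
  have hb : ∀ n, |a n| ≤ 1 := by
    intro n
    have := h01 n 0
    rw [abs_le]; simp only [ha]
    constructor <;> linarith
  have key := urn_seq m hm ε hε hε1 a hrec h0 hb t (m - i.val) (by omega)
  have hi : a (t + (m - i.val)) = (P^(t+m)) i s - v := by
    have := hshift i.val i.isLt (t + (m - i.val))
    rw [show t + (m - i.val) + i.val = t + m by omega] at this
    simp only [ha]; rw [← this]
  rw [hi] at key
  refine abs_le_of_sq_le_sq (key.trans ?_) (by positivity)
  rw [mul_pow, ← Real.exp_nat_mul]
  have e : ((2:ℕ):ℝ) * (-((1-ε)/(4*(1+m)^2)) * (t/m : ℕ)) = -((1-ε)/(2*(1+m)^2)) * (t/m : ℕ) := by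
    push_cast; field_simp; ring
  rw [e]
  refine mul_le_mul_of_nonneg_right ?_ (Real.exp_pos _).le
  have : 1 ≤ (1 + (m:ℝ)) / ε := by rw [le_div_iff₀ hε]; linarith
  nlinarith

lemma urn_tv (M T : ℕ) (hM : 2 ≤ M) (hT : M ≤ T) (ε : ℝ) (hε : 0 < ε) (hε1 : ε < 1)
    (μ₀ : Fin M → ℝ) (hμ : ∀ i, 0 ≤ μ₀ i) (h1 : ∑ i, μ₀ i = 1) :
    tvDist (μ₀ ᵥ* (urnMat M ε) ^ T) (urnNu M ε) ≤
      (M:ℝ)^2 / ε * Real.exp (1 - (1-ε)/4 * (T / (M:ℝ)^3)) := by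
  obtain ⟨m, rfl⟩ : ∃ m, M = m + 1 := ⟨M - 1, by omega⟩
  obtain ⟨t, rfl⟩ : ∃ t, T = t + m := ⟨T - m, by omega⟩
  have hm : 1 ≤ m := by omega
  have hmR : (1:ℝ) ≤ m := by exact_mod_cast hm
  set B := (1 + m) / ε * Real.exp (-((1-ε)/(4*(1+m)^2)) * (t/m : ℕ)) with hB
  have hcol : ∀ s, |(μ₀ ᵥ* (urnMat (m+1) ε) ^ (t+m)) s - urnNu (m+1) ε s| ≤ B := by
    intro s
    have e : (μ₀ ᵥ* (urnMat (m+1) ε) ^ (t+m)) s - urnNu (m+1) ε s =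
        ∑ i, μ₀ i * (((urnMat (m+1) ε) ^ (t+m)) i s - urnNu (m+1) ε s) := by
      simp only [mul_sub, Finset.sum_sub_distrib, ← Finset.sum_mul, h1, one_mul]
      rfl
    rw [e]
    refine (Finset.abs_sum_le_sum_abs _ _).trans ?_
    calc ∑ i, |μ₀ i * (((urnMat (m+1) ε) ^ (t+m)) i s - urnNu (m+1) ε s)|
        ≤ ∑ i, μ₀ i * B := by
          refine Finset.sum_le_sum fun i _ => ?_
          rw [abs_mul, abs_of_nonneg (hμ i)]
          exact mul_le_mul_of_nonneg_left (urn_bound m hm ε hε hε1 t i s) (hμ i)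
      _ = B := by rw [← Finset.sum_mul, h1, one_mul]
  have hBnn : 0 ≤ B := by positivity
  have hsum : tvDist (μ₀ ᵥ* (urnMat (m+1) ε) ^ (t+m)) (urnNu (m+1) ε) ≤ (1+m) * B := by
    have h2 := Finset.sum_le_card_nsmul Finset.univ
      (fun s => |(μ₀ ᵥ* (urnMat (m+1) ε) ^ (t+m)) s - urnNu (m+1) ε s|) B (fun s _ => hcol s)
    simp only [Finset.card_univ, Fintype.card_fin, nsmul_eq_mul] at h2
    push_cast at h2
    unfold tvDist
    have : 0 ≤ (1+(m:ℝ)) * B := by positivity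
    linarith
  refine hsum.trans ?_
  have hdiv : ((t + m : ℕ):ℝ) / ((m:ℝ)+1) - 2 ≤ ((t/m : ℕ):ℝ) := by
    have h3 : t < m * (t/m + 1) := Nat.lt_mul_div_succ t (by omega)
    have h4 : (t:ℝ) < m * ((t/m : ℕ) + 1) := by exact_mod_cast h3
    have h5 : (0:ℝ) ≤ ((t/m : ℕ):ℝ) := by positivity
    rw [sub_le_iff_le_add, div_le_iff₀ (by positivity)]
    push_cast at *
    nlinarith
  have hexp : -((1-ε)/(4*(1+m)^2)) * ((t/m : ℕ):ℝ) ≤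
      1 - (1-ε)/4 * (((t+m : ℕ):ℝ) / ((m+1 : ℕ):ℝ)^3) := by
    set c := (1-ε)/(4*(1+(m:ℝ))^2) with hc
    have hc0 : 0 ≤ c := div_nonneg (by linarith) (by positivity)
    have hc1 : c ≤ 1/2 := by
      rw [hc, div_le_iff₀ (by positivity)]; nlinarith
    have e : (1-ε)/4 * (((t+m : ℕ):ℝ) / ((m+1 : ℕ):ℝ)^3) = c * (((t + m : ℕ):ℝ) / ((m:ℝ)+1)) := by
      rw [hc]; push_cast; field_simp; ring
    rw [e]
    have := mul_le_mul_of_nonneg_left hdiv hc0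
    linarith
  rw [hB]
  have := Real.exp_le_exp.mpr hexp
  calc (1+(m:ℝ)) * ((1 + m) / ε * Real.exp (-((1-ε)/(4*(1+m)^2)) * (t/m : ℕ)))
      = ((m+1:ℕ):ℝ)^2/ε * Real.exp (-((1-ε)/(4*(1+m)^2)) * (t/m : ℕ)) := by
        push_cast; ring
    _ ≤ _ := mul_le_mul_of_nonneg_left this (by positivity)

/-- Mixing of the strong seed-bank urn chain: for all `λ > 3β` there exist `δ > 0` and `N₀`
such that for all `N ≥ N₀` and all initial distributions `μ₀` on `{0,...,N^β-1}`,
`‖P_{μ₀}(X_{⌊N^λ⌋} ∈ ·) - ν_N‖_TV ≤ exp(-N^δ)`. -/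
theorem urn_mixing (β ε : ℝ) (hβ : 0 < β) (hε : ε ∈ Set.Ioo (0:ℝ) 1)
    (lam : ℝ) (hlam : 3 * β < lam) :
    ∃ δ > (0:ℝ), ∃ N₀ : ℕ, ∀ N : ℕ, N₀ ≤ N →
      ∀ μ₀ : Fin ⌊(N : ℝ) ^ β⌋₊ → ℝ, (∀ i, 0 ≤ μ₀ i) → ∑ i, μ₀ i = 1 →
        tvDist (μ₀ ᵥ* (urnMat ⌊(N : ℝ) ^ β⌋₊ ε) ^ ⌊(N : ℝ) ^ lam⌋₊)
            (urnNu ⌊(N : ℝ) ^ β⌋₊ ε) ≤ Real.exp (-(N : ℝ) ^ δ) := by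
  obtain ⟨hε0, hε1⟩ := hε
  set η := lam - 3*β with hη
  have hη0 : 0 < η := by linarith
  refine ⟨η/2, by positivity, ?_⟩
  have hcast : Filter.Tendsto (fun N : ℕ => (N:ℝ)) Filter.atTop Filter.atTop :=
    tendsto_natCast_atTop_atTop
  have e1 : ∀ᶠ N : ℕ in Filter.atTop, (2:ℝ) ≤ (N:ℝ)^β :=
    ((tendsto_rpow_atTop hβ).comp hcast).eventually_ge_atTop 2
  have hlog : ∀ᶠ x : ℝ in Filter.atTop,
      2*β*Real.log x + x^(η/2) + (2 - Real.log ε) ≤ (1-ε)/4 * x^η := by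
    have c0 : 0 < (1-ε)/12 := by linarith
    have l1 := ((isLittleO_log_rpow_atTop hη0).const_mul_left (2*β)).bound c0
    have l2 := ((tendsto_rpow_atTop (half_pos hη0)).const_mul_atTop c0).eventually_ge_atTop 1
    have l3 := ((tendsto_rpow_atTop hη0).const_mul_atTop c0).eventually_ge_atTop (2 - Real.log ε)
    filter_upwards [l1, l2, l3, Filter.eventually_ge_atTop (1:ℝ)] with x h1 h2 h3 hx
    have hx0 : 0 ≤ x^η := Real.rpow_nonneg (by linarith) _
    have h1' := (le_abs_self _).trans h1
    rw [Real.norm_of_nonneg hx0] at h1'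
    have h2' : x^(η/2) ≤ (1-ε)/12 * x^η := by
      have hh : x^η = x^(η/2) * x^(η/2) := by
        rw [← Real.rpow_add (by linarith)]; ring_nf
      have hy : 0 ≤ x^(η/2) := Real.rpow_nonneg (by linarith) _
      rw [hh]
      nlinarith [mul_le_mul_of_nonneg_right h2 hy]
    linarith
  have e2 := hcast.eventually hlog
  obtain ⟨N₀, hN₀⟩ := Filter.eventually_atTop.mp
    ((e1.and e2).and (Filter.eventually_ge_atTop 1))
  refine ⟨N₀, fun N hN => ?_⟩
  obtain ⟨⟨hN1, hN2⟩, hN3⟩ := hN₀ N hN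
  have hx1 : (1:ℝ) ≤ N := by exact_mod_cast hN3
  have hx0 : (0:ℝ) < N := by linarith
  set M := ⌊(N : ℝ) ^ β⌋₊ with hM
  set T := ⌊(N : ℝ) ^ lam⌋₊ with hT
  intro μ₀ hμ h1
  have hM2 : 2 ≤ M := Nat.le_floor (by exact_mod_cast hN1)
  have hMT : M ≤ T := Nat.floor_le_floor (Real.rpow_le_rpow_of_exponent_le hx1 (by linarith))
  have hMle : (M:ℝ) ≤ (N:ℝ)^β := Nat.floor_le (by positivity)
  have hTge : (N:ℝ)^lam - 1 ≤ T := (Nat.sub_one_lt_floor _).le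
  refine (urn_tv M T hM2 hMT ε hε0 hε1 μ₀ hμ h1).trans ?_
  have hM0 : (2:ℝ) ≤ M := by exact_mod_cast hM2
  have hM3 : (M:ℝ)^3 ≤ (N:ℝ)^(3*β) := by
    calc (M:ℝ)^3 ≤ ((N:ℝ)^β)^3 := pow_le_pow_left₀ (by positivity) hMle 3
      _ = (N:ℝ)^(3*β) := by
        rw [← Real.rpow_natCast, ← Real.rpow_mul hx0.le]; push_cast; ring_nf
  have hM22 : (M:ℝ)^2 ≤ Real.exp (2*β*Real.log N) := by
    calc (M:ℝ)^2 ≤ ((N:ℝ)^β)^2 := pow_le_pow_left₀ (by positivity) hMle 2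
      _ = Real.exp (2*β*Real.log N) := by
        rw [← Real.rpow_natCast, ← Real.rpow_mul hx0.le, Real.rpow_def_of_pos hx0]
        push_cast; ring_nf
  have hTM : (N:ℝ)^η - 1 ≤ T / (M:ℝ)^3 := by
    have hp : (0:ℝ) < (N:ℝ)^(3*β) := by positivity
    have hp1 : (1:ℝ) ≤ (N:ℝ)^(3*β) := Real.one_le_rpow hx1 (by positivity)
    calc (N:ℝ)^η - 1 ≤ ((N:ℝ)^lam - 1) / (N:ℝ)^(3*β) := by
          rw [hη, Real.rpow_sub hx0, sub_div]
          have : 1 / (N:ℝ)^(3*β) ≤ 1 := by rw [div_le_one hp]; exact hp1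
          linarith
      _ ≤ T / (N:ℝ)^(3*β) := by gcongr
      _ ≤ T / (M:ℝ)^3 := by gcongr
  have hεe : (1:ℝ)/ε = Real.exp (-Real.log ε) := by
    rw [Real.exp_neg, Real.exp_log hε0, one_div]
  calc (M:ℝ)^2 / ε * Real.exp (1 - (1-ε)/4 * (T / (M:ℝ)^3))
      = (M:ℝ)^2 * (1/ε) * Real.exp (1 - (1-ε)/4 * (T / (M:ℝ)^3)) := by ring
    _ ≤ Real.exp (2*β*Real.log N) * Real.exp (-Real.log ε) *
        Real.exp (1 - (1-ε)/4 * (T / (M:ℝ)^3)) := by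
        rw [hεe]
        gcongr
    _ = Real.exp (2*β*Real.log N + -Real.log ε + (1 - (1-ε)/4 * (T / (M:ℝ)^3))) := by
        rw [Real.exp_add, Real.exp_add]
    _ ≤ Real.exp (-(N:ℝ)^(η/2)) := by
        rw [Real.exp_le_exp]
        have := mul_le_mul_of_nonneg_left hTM (show 0 ≤ (1-ε)/4 by linarith)
        linarith
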